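/- arXiv:2310.14462 — 3 statements merged into one kernel-verified Lean document; each statement's English description precedes it below -/
import Mathlib

section
/- Let G be a subgroup of ⟨σ⟩ of order n; set z = Σ_{τ∈G} τ(x) and y = ∏_{τ∈G} τ(1/Q(x)) in 𝔽_q(x). Then [𝔽_q(x) : 𝔽_q(y)] = 2n; moreover y lies in the subfield 𝔽_q(z) and [𝔽_q(z) : 𝔽_q(y)] = 2. -/
open Polynomial

namespace RatFunc

variable {K : Type*} [Field K]

theorem finrank_adjoin_div_le {p d : K[X]} (hd : d ≠ 0) {n : ℕ} (hpn : p.natDegree ≤ n)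
    (hdn : d.natDegree ≤ n) :
    Module.finrank (IntermediateField.adjoin K
      {(algebraMap K[X] (RatFunc K) p / algebraMap K[X] (RatFunc K) d)}) (RatFunc K) ≤ n := by
  rw [finrank_eq_max_natDegree, max_le_iff]
  refine ⟨?_, (natDegree_le_of_dvd (denom_div_dvd p d) hd).trans hdn⟩
  rcases eq_or_ne p 0 with rfl | hp
  · simp
  · exact (natDegree_le_of_dvd (num_div_dvd p hd) hp).trans hpn

theorem finrank_adjoin_div_of_isCoprime {p d : K[X]} (hp : p ≠ 0) (hd : d ≠ 0)
    (hpd : IsCoprime p d) :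
    Module.finrank (IntermediateField.adjoin K
      {(algebraMap K[X] (RatFunc K) p / algebraMap K[X] (RatFunc K) d)}) (RatFunc K) =
      max p.natDegree d.natDegree := by
  refine le_antisymm (finrank_adjoin_div_le hd (le_max_left _ _) (le_max_right _ _)) ?_
  rw [finrank_eq_max_natDegree]
  set f := algebraMap K[X] (RatFunc K) p / algebraMap K[X] (RatFunc K) d with hf
  have hf0 : f ≠ 0 := div_ne_zero (algebraMap_ne_zero hp) (algebraMap_ne_zero hd)
  have h : f.num * d = p * f.denom := (num_mul_eq_mul_denom_iff hd).mpr hf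
  refine max_le_max (natDegree_le_of_dvd ?_ (num_ne_zero hf0))
    (natDegree_le_of_dvd ?_ f.denom_ne_zero)
  · exact hpd.dvd_of_dvd_mul_right ⟨_, h⟩
  · exact hpd.symm.dvd_of_dvd_mul_left ⟨f.num, by rw [← h, mul_comm]⟩

theorem intDegree_add_le_of_le {f g : RatFunc K} {n : ℤ} (hn : 0 ≤ n) (hf : f.intDegree ≤ n)
    (hg : g.intDegree ≤ n) : (f + g).intDegree ≤ n := by
  rcases eq_or_ne g 0 with rfl | hg0
  · simpa using hf
  rcases eq_or_ne (f + g) 0 with h | h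
  · simpa [h] using hn
  · exact (intDegree_add_le hg0 h).trans (max_le hf hg)

theorem intDegree_sum_le_of_le {ι : Type*} (s : Finset ι) (f : ι → RatFunc K) {n : ℤ}
    (hn : 0 ≤ n) (h : ∀ i ∈ s, (f i).intDegree ≤ n) : (∑ i ∈ s, f i).intDegree ≤ n :=
  Finset.sum_induction f (fun g ↦ g.intDegree ≤ n)
    (fun _ _ ↦ intDegree_add_le_of_le hn) (by simpa using hn) h

theorem intDegree_div_nonpos {p d : K[X]} (h : p.natDegree ≤ d.natDegree) :
    (algebraMap K[X] (RatFunc K) p / algebraMap K[X] (RatFunc K) d).intDegree ≤ 0 := by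
  rcases eq_or_ne p 0 with rfl | hp
  · simp
  rcases eq_or_ne d 0 with rfl | hd
  · simp
  rw [intDegree_div (algebraMap_ne_zero hp) (algebraMap_ne_zero hd), intDegree_polynomial,
    intDegree_polynomial]
  omega

theorem exists_sum_div_eq {ι : Type*} (s : Finset ι) (p d : ι → K[X])
    (hd : ∀ i ∈ s, d i ≠ 0) (hp1 : ∀ i ∈ s, (p i).natDegree ≤ 1)
    (hd1 : ∀ i ∈ s, (d i).natDegree ≤ 1) :
    ∃ P D : K[X], D ≠ 0 ∧ P.natDegree ≤ s.card ∧ D.natDegree ≤ s.card ∧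
      ∑ i ∈ s, algebraMap K[X] (RatFunc K) (p i) / algebraMap K[X] (RatFunc K) (d i) =
        algebraMap K[X] (RatFunc K) P / algebraMap K[X] (RatFunc K) D := by
  classical
  induction s using Finset.induction_on with
  | empty => exact ⟨0, 1, one_ne_zero, by simp, by simp, by simp⟩
  | insert i s his ih =>
    simp only [Finset.mem_insert, forall_eq_or_imp] at hd hp1 hd1
    obtain ⟨P, D, hD, hPs, hDs, h⟩ := ih hd.2 hp1.2 hd1.2
    rw [Finset.card_insert_of_notMem his, add_comm]
    refine ⟨p i * D + d i * P, d i * D, mul_ne_zero hd.1 hD,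
      natDegree_add_le_of_degree_le (natDegree_mul_le_of_le hp1.1 hDs)
        (natDegree_mul_le_of_le hd1.1 hPs), natDegree_mul_le_of_le hd1.1 hDs, ?_⟩
    rw [Finset.sum_insert his, h, div_add_div _ _ (algebraMap_ne_zero hd.1)
      (algebraMap_ne_zero hD)]
    simp only [map_add, map_mul]

theorem algEquiv_eq_one_of_apply_X {τ : RatFunc K ≃ₐ[K] RatFunc K} (h : τ X = X) : τ = 1 := by
  have hle : (⊤ : IntermediateField K (RatFunc K)) ≤
      IntermediateField.fixedField (Subgroup.zpowers τ) := by
    rw [← adjoin_X, IntermediateField.adjoin_simple_le_iff, IntermediateField.mem_fixedField_iff]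
    intro g hg
    have hstab : Subgroup.zpowers τ ≤ MulAction.stabilizer (RatFunc K ≃ₐ[K] RatFunc K)
        (X : RatFunc K) := by
      rw [Subgroup.zpowers_le]
      exact h
    exact hstab hg
  refine AlgEquiv.ext fun f ↦ ?_
  exact (IntermediateField.mem_fixedField_iff _ _).mp (hle (IntermediateField.mem_top (x := f))) τ
    (Subgroup.mem_zpowers τ)

theorem algEquiv_apply_C (τ : RatFunc K ≃ₐ[K] RatFunc K) (r : K) : τ (C r) = C r :=
  τ.commutes r

end RatFunc

section Mobius

variable {K : Type*} [Field K]

/-- The numerator of the Möbius transformation with matrix `!![d, c; -b * c, d - a * c]`. -/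
noncomputable def mobiusNum (c d : K) : K[X] := C d * X + C c

/-- The denominator of the Möbius transformation with matrix `!![d, c; -b * c, d - a * c]`. -/
noncomputable def mobiusDenom (a b c d : K) : K[X] := C (-(b * c)) * X + C (d - a * c)

variable {a b c d : K}

theorem natDegree_mobiusNum_le : (mobiusNum c d).natDegree ≤ 1 := natDegree_linear_le

theorem natDegree_mobiusDenom_le : (mobiusDenom a b c d).natDegree ≤ 1 := natDegree_linear_le

theorem natDegree_mobiusDenom (hb : b ≠ 0) (hc : c ≠ 0) : (mobiusDenom a b c d).natDegree = 1 :=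
  natDegree_linear (neg_ne_zero.mpr (mul_ne_zero hb hc))

theorem mobiusDenom_ne_zero (hb : b ≠ 0) (h : c ≠ 0 ∨ d ≠ 0) : mobiusDenom a b c d ≠ 0 := by
  intro h0
  have h1 : c = 0 := by simpa [mobiusDenom, hb, coeff_C] using congrArg (coeff · 1) h0
  subst h1
  simp_all [mobiusDenom]

theorem exists_apply_X_eq_mobius (hb : b ≠ 0) {σ : RatFunc K ≃ₐ[K] RatFunc K}
    (hσ : σ RatFunc.X = 1 / (-(RatFunc.C b) * RatFunc.X - RatFunc.C a))
    (hfin : IsOfFinOrder σ) {τ : RatFunc K ≃ₐ[K] RatFunc K} (hτ : τ ∈ Subgroup.zpowers σ) :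
    ∃ c d : K, (c ≠ 0 ∨ d ≠ 0) ∧ τ RatFunc.X =
      algebraMap K[X] (RatFunc K) (mobiusNum c d) /
        algebraMap K[X] (RatFunc K) (mobiusDenom a b c d) := by
  rw [← hfin.mem_powers_iff_mem_zpowers] at hτ
  obtain ⟨i, rfl⟩ := hτ
  simp only
  induction i with
  | zero => exact ⟨0, 1, by simp, by simp [mobiusNum, mobiusDenom]⟩
  | succ i ih =>
    obtain ⟨c, d, hcd, h⟩ := ih
    have hcd' : d - a * c ≠ 0 ∨ -(b * c) ≠ 0 := by
      by_contra! hcon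
      obtain ⟨h1, h2⟩ := hcon
      have hc : c = 0 := by simpa [hb] using h2
      subst hc
      simp_all
    refine ⟨d - a * c, -(b * c), hcd', ?_⟩
    have hL : -(RatFunc.C b) * RatFunc.X - RatFunc.C a ≠ (0 : RatFunc K) := by
      intro h0
      rw [h0, div_zero, EmbeddingLike.map_eq_zero_iff] at hσ
      exact RatFunc.X_ne_zero hσ
    have hD := RatFunc.algebraMap_ne_zero (mobiusDenom_ne_zero (a := a) hb hcd')
    rw [pow_succ', AlgEquiv.mul_apply, h, map_div₀]
    have hD' : σ (algebraMap K[X] (RatFunc K) (mobiusDenom a b c d)) ≠ 0 :=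
      (map_ne_zero σ).mpr (RatFunc.algebraMap_ne_zero (mobiusDenom_ne_zero hb hcd))
    rw [div_eq_div_iff hD' hD]
    simp only [mobiusNum, mobiusDenom, map_add, map_mul, RatFunc.algebraMap_X,
      RatFunc.algebraMap_C, RatFunc.algEquiv_apply_C, hσ, map_sub, map_neg]
    linear_combination (RatFunc.C d * (RatFunc.C d - RatFunc.C a * RatFunc.C c) +
      RatFunc.C b * RatFunc.C c ^ 2) * one_div_mul_cancel hL

theorem exists_apply_quadratic_eq (hb : b ≠ 0) (hcd : c ≠ 0 ∨ d ≠ 0)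
    {τ : RatFunc K ≃ₐ[K] RatFunc K}
    (hτ : τ RatFunc.X = algebraMap K[X] (RatFunc K) (mobiusNum c d) /
        algebraMap K[X] (RatFunc K) (mobiusDenom a b c d)) :
    ∃ k : K, k ≠ 0 ∧
      τ (1 / algebraMap K[X] (RatFunc K) (X ^ 2 + C (a / b) * X + C (1 / b))) =
        algebraMap K[X] (RatFunc K) (mobiusDenom a b c d ^ 2) /
          algebraMap K[X] (RatFunc K) (C k * (X ^ 2 + C (a / b) * X + C (1 / b))) := by
  set Q : K[X] := X ^ 2 + C (a / b) * X + C (1 / b) with hQ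
  have hL := RatFunc.algebraMap_ne_zero (mobiusDenom_ne_zero (a := a) hb hcd)
  have key : mobiusNum c d ^ 2 + C (a / b) * mobiusNum c d * mobiusDenom a b c d +
      C (1 / b) * mobiusDenom a b c d ^ 2 = C (d ^ 2 - a * c * d + b * c ^ 2) * Q := by
    have h1 : (C b : K[X]) * C (a / b) = C a := by rw [← C_mul, mul_div_cancel₀ _ hb]
    have h2 : (C b : K[X]) * C (1 / b) = 1 := by rw [← C_mul, mul_div_cancel₀ _ hb, C_1]
    apply mul_left_cancel₀ (C_ne_zero.mpr hb)
    simp only [hQ, mobiusNum, mobiusDenom, C_sub, C_add, C_mul, C_pow, C_neg]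
    rw [← h1]
    linear_combination ((-(C b * C c) * X + (C d - C b * C (a / b) * C c)) ^ 2 -
      (C d ^ 2 - C b * C (a / b) * C c * C d + C b * C c ^ 2)) * h2
  have hτQ : τ (algebraMap K[X] (RatFunc K) Q) =
      algebraMap K[X] (RatFunc K) (C (d ^ 2 - a * c * d + b * c ^ 2) * Q) /
        algebraMap K[X] (RatFunc K) (mobiusDenom a b c d ^ 2) := by
    rw [← key, hQ]
    simp only [map_add, map_mul, map_pow, RatFunc.algebraMap_X,
      RatFunc.algebraMap_C, RatFunc.algEquiv_apply_C, hτ]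
    field_simp
  refine ⟨d ^ 2 - a * c * d + b * c ^ 2, ?_, ?_⟩
  · intro hk
    rw [hk, C_0, zero_mul, map_zero, zero_div, EmbeddingLike.map_eq_zero_iff] at hτQ
    have hQ0 : Q ≠ 0 := fun h0 ↦ by
      simpa [hQ, coeff_X, coeff_C, -one_div] using congrArg (coeff · 2) h0
    exact RatFunc.algebraMap_ne_zero hQ0 hτQ
  · rw [map_div₀, map_one, hτQ, one_div_div]

theorem natDegree_monic_quadratic (u v : K) : (X ^ 2 + C u * X + C v : K[X]).natDegree = 2 := by
  compute_degree!

theorem irreducible_quadratic_reverse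
    (h : Irreducible (X ^ 2 + C a * X + C b : K[X])) (hb : b ≠ 0) :
    Irreducible (X ^ 2 + C (a / b) * X + C (1 / b) : K[X]) := by
  refine irreducible_of_degree_le_three_of_not_isRoot
    (by rw [natDegree_monic_quadratic]; decide) ?_
  intro r hr
  have hr' : r ^ 2 + a / b * r + 1 / b = 0 := by simpa using hr
  have hr0 : r ≠ 0 := by
    rintro rfl
    simp [hb] at hr'
  refine h.not_isRoot_of_natDegree_ne_one (by rw [natDegree_monic_quadratic]; decide)
    (x := r⁻¹) ?_
  field_simp at hr'
  simp only [IsRoot.def, eval_add, eval_mul, eval_pow, eval_X, eval_C]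
  field_simp
  linear_combination hr'

end Mobius

/-- **Degrees of the subfields `𝔽_q(y) ⊆ 𝔽_q(z) ⊆ 𝔽_q(x)`.**
With `σ` of order `q+1` from a primitive quadratic `m(X) = X² + aX + b`,
`Q(X) = X² + (a/b)X + 1/b`, `G ≤ ⟨σ⟩` of order `n`, `z = Σ_{τ∈G} τ(x)` and
`y = ∏_{τ∈G} τ(1/Q(x))`: `[𝔽_q(x) : 𝔽_q(y)] = 2n`, `y ∈ 𝔽_q(z)`, and
`[𝔽_q(z) : 𝔽_q(y)] = 2`. -/
theorem degree_of_subfields_y_z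
    (Fq : Type*) [Field Fq] [Fintype Fq] (a b : Fq)
    (m : Polynomial Fq) (hm : m = X ^ 2 + C a * X + C b)
    (hirr : Irreducible m)
    (hprim : orderOf (AdjoinRoot.root m) = Fintype.card Fq ^ 2 - 1)
    (σ : RatFunc Fq ≃ₐ[Fq] RatFunc Fq)
    (hσ : σ RatFunc.X = 1 / (-(RatFunc.C b) * RatFunc.X - RatFunc.C a))
    (horder : orderOf σ = Fintype.card Fq + 1)
    (Qp : Polynomial Fq) (hQ : Qp = X ^ 2 + C (a / b) * X + C (1 / b))
    (n : ℕ) (G : Subgroup (RatFunc Fq ≃ₐ[Fq] RatFunc Fq)) [Fintype G]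
    (hG : G ≤ Subgroup.zpowers σ) (hn : Fintype.card G = n)
    (z y : RatFunc Fq)
    (hz : z = ∑ τ : G, (τ : RatFunc Fq ≃ₐ[Fq] RatFunc Fq) RatFunc.X)
    (hy : y = ∏ τ : G, (τ : RatFunc Fq ≃ₐ[Fq] RatFunc Fq)
      (1 / algebraMap (Polynomial Fq) (RatFunc Fq) Qp)) :
    Module.finrank (IntermediateField.adjoin Fq {y}) (RatFunc Fq) = 2 * n ∧
    y ∈ IntermediateField.adjoin Fq {z} ∧
    ∀ h : IntermediateField.adjoin Fq {y} ≤ IntermediateField.adjoin Fq {z},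
      Module.finrank (IntermediateField.adjoin Fq {y})
        (IntermediateField.extendScalars h) = 2 := by
  classical
  subst hm hQ hn
  have hb : b ≠ 0 := by
    rintro rfl
    exact hirr.not_isRoot_of_natDegree_ne_one (by rw [natDegree_monic_quadratic]; decide)
      (x := 0) (by simp)
  have hQirr := irreducible_quadratic_reverse hirr hb
  have hfin : IsOfFinOrder σ := orderOf_pos_iff.mp (by omega)
  choose c d hcd hX using fun τ : G ↦ exists_apply_X_eq_mobius hb hσ hfin (hG τ.2)
  choose k hk hτQ using fun τ : G ↦ exists_apply_quadratic_eq hb (hcd τ) (hX τ)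
  have hcop (τ : G) : IsCoprime (mobiusDenom a b (c τ) (d τ))
      (X ^ 2 + C (a / b) * X + C (1 / b)) := by
    refine ((hQirr.coprime_iff_not_dvd).mpr fun hdvd ↦ ?_).symm
    have h1 := natDegree_le_of_dvd hdvd (mobiusDenom_ne_zero hb (hcd τ))
    rw [natDegree_monic_quadratic] at h1
    exact absurd (h1.trans natDegree_mobiusDenom_le) (by decide)
  have hy_finrank : Module.finrank (IntermediateField.adjoin Fq {y}) (RatFunc Fq) =
      2 * Fintype.card G := by
    have hyeq : y = algebraMap Fq[X] (RatFunc Fq) (∏ τ : G, mobiusDenom a b (c τ) (d τ) ^ 2) /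
        algebraMap Fq[X] (RatFunc Fq)
          (∏ τ : G, (C (k τ) * (X ^ 2 + C (a / b) * X + C (1 / b)))) := by
      rw [hy, map_prod, map_prod, ← Finset.prod_div_distrib]
      exact Finset.prod_congr rfl fun τ _ ↦ hτQ τ
    have hne (τ : G) : (C (k τ) * (X ^ 2 + C (a / b) * X + C (1 / b)) : Fq[X]) ≠ 0 :=
      mul_ne_zero (C_ne_zero.mpr (hk τ)) hQirr.ne_zero
    rw [hyeq, RatFunc.finrank_adjoin_div_of_isCoprime
      (Finset.prod_ne_zero_iff.mpr fun τ _ ↦ pow_ne_zero 2 (mobiusDenom_ne_zero hb (hcd τ)))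
      (Finset.prod_ne_zero_iff.mpr fun τ _ ↦ hne τ)]
    · have hdeg : (∏ τ : G, (C (k τ) * (X ^ 2 + C (a / b) * X + C (1 / b)))).natDegree =
          2 * Fintype.card G := by
        rw [natDegree_prod _ _ fun τ _ ↦ hne τ]
        simp only [natDegree_C_mul (hk _), natDegree_monic_quadratic, Finset.sum_const,
          Finset.card_univ, smul_eq_mul]
        exact mul_comm _ _
      rw [hdeg, max_eq_right]
      refine (natDegree_prod_le _ _).trans ?_
      refine (Finset.sum_le_card_nsmul _ _ 2 fun τ _ ↦ ?_).trans (by simp [mul_comm])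
      exact natDegree_pow_le_of_le 2 natDegree_mobiusDenom_le
    · refine IsCoprime.prod_left fun τ _ ↦ IsCoprime.prod_right fun τ' _ ↦ IsCoprime.pow_left ?_
      exact (isCoprime_mul_unit_left_right (isUnit_C.mpr (hk τ').isUnit) _ _).mpr (hcop τ)
  have hz_nonconst : ¬ ∃ r, z = RatFunc.C r := by
    rintro ⟨r, hr⟩
    rw [hz, ← Finset.add_sum_erase _ _ (Finset.mem_univ (1 : G))] at hr
    have h1 : (RatFunc.X : RatFunc Fq) = RatFunc.C r +
        -∑ τ ∈ Finset.univ.erase (1 : G), (τ : RatFunc Fq ≃ₐ[Fq] RatFunc Fq) RatFunc.X := by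
      rw [← hr]
      simp
    have h2 : (RatFunc.X : RatFunc Fq).intDegree ≤ 0 := by
      rw [h1]
      refine RatFunc.intDegree_add_le_of_le le_rfl (by simp) ?_
      rw [RatFunc.intDegree_neg]
      refine RatFunc.intDegree_sum_le_of_le _ _ le_rfl fun τ hτ ↦ ?_
      rw [hX τ]
      refine RatFunc.intDegree_div_nonpos (natDegree_mobiusNum_le.trans_eq
        (natDegree_mobiusDenom hb ?_).symm)
      intro hc
      refine Finset.ne_of_mem_erase hτ (Subtype.ext (RatFunc.algEquiv_eq_one_of_apply_X ?_))
      have hd : d τ ≠ 0 := by simpa [hc] using hcd τ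
      have hd' : RatFunc.C (d τ) ≠ 0 := (_root_.map_ne_zero _).mpr hd
      rw [hX τ, hc]
      simp [mobiusNum, mobiusDenom, hd']
    simp at h2
  have hz_le : Module.finrank (IntermediateField.adjoin Fq {z}) (RatFunc Fq) ≤
      Fintype.card G := by
    obtain ⟨P, D, hD, hPs, hDs, h⟩ := RatFunc.exists_sum_div_eq (Finset.univ : Finset G)
      (fun τ ↦ mobiusNum (c τ) (d τ)) (fun τ ↦ mobiusDenom a b (c τ) (d τ))
      (fun τ _ ↦ mobiusDenom_ne_zero hb (hcd τ)) (fun _ _ ↦ natDegree_mobiusNum_le)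
      (fun _ _ ↦ natDegree_mobiusDenom_le)
    have hzeq : z = algebraMap Fq[X] (RatFunc Fq) P / algebraMap Fq[X] (RatFunc Fq) D := by
      rw [hz, ← h]
      exact Finset.sum_congr rfl fun τ _ ↦ hX τ
    rw [hzeq]
    exact RatFunc.finrank_adjoin_div_le hD hPs hDs
  have hfixed : Module.finrank (IntermediateField.fixedField G) (RatFunc Fq) =
      Fintype.card G := FixedPoints.finrank_eq_card G (RatFunc Fq)
  have hz_mem : z ∈ IntermediateField.fixedField G := by
    rw [IntermediateField.mem_fixedField_iff]
    intro g hg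
    rw [hz, map_sum]
    exact Fintype.sum_equiv (Equiv.mulLeft (⟨g, hg⟩ : G)) _ _ fun τ ↦ rfl
  have hy_mem : y ∈ IntermediateField.fixedField G := by
    rw [IntermediateField.mem_fixedField_iff]
    intro g hg
    rw [hy, map_prod]
    exact Fintype.prod_equiv (Equiv.mulLeft (⟨g, hg⟩ : G)) _ _ fun τ ↦ rfl
  have hz_eq : IntermediateField.adjoin Fq {z} = IntermediateField.fixedField G := by
    have hz_alg := z.isAlgebraic_adjoin_simple_X hz_nonconst
    have : FiniteDimensional (IntermediateField.adjoin Fq {z}) (RatFunc Fq) := by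
      have := IntermediateField.adjoin.finiteDimensional hz_alg.isIntegral
      exact (RatFunc.IntermediateField.adjoinXEquiv
        (IntermediateField.adjoin Fq {z})).toLinearEquiv.finiteDimensional
    exact IntermediateField.eq_of_le_of_finrank_le'
      (IntermediateField.adjoin_simple_le_iff.mpr hz_mem) (hz_le.trans_eq hfixed.symm)
  refine ⟨hy_finrank, hz_eq ▸ hy_mem, fun h ↦ ?_⟩
  have hz_finrank : Module.finrank (IntermediateField.extendScalars h) (RatFunc Fq) =
      Fintype.card G := by
    rw [← hfixed, ← hz_eq]
    rfl
  have htower := Module.finrank_mul_finrank (IntermediateField.adjoin Fq {y})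
    (IntermediateField.extendScalars h) (RatFunc Fq)
  rw [hy_finrank, hz_finrank] at htower
  exact Nat.eq_of_mul_eq_mul_right Fintype.card_pos htower
end

section
/- Let G = ⟨σ⟩ be the full cyclic group of order q+1. Then there exist a polynomial u ∈ 𝔽_q[X] of degree q+1 and a constant c ∈ 𝔽_q^× such that, in 𝔽_q(x), Σ_{τ∈⟨σ⟩} τ(x) = u(x)/(x^q − x) and ∏_{τ∈⟨σ⟩} τ(1/Q(x)) = (x^q − x)^2 / (c · Q(x)^{q+1}). -/
open Polynomial

/-- The images of `X` under the Möbius transformations in the centralizer of `X ↦ 1 / (-bX - a)`: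
the identity and, for each `r`, the transformation with pole at `r`. -/
noncomputable def centralizerValue {F : Type*} [Field F] (a b : F) : Option F → RatFunc F
  | none => RatFunc.X
  | some r => (RatFunc.C (a + b * r) * RatFunc.X + 1) / (RatFunc.C (-b) * (RatFunc.X - RatFunc.C r))

theorem ratFunc_X_sub_C_ne_zero {F : Type*} [Field F] (r : F) :
    (RatFunc.X - RatFunc.C r : RatFunc F) ≠ 0 := by
  rw [← RatFunc.algebraMap_X, ← RatFunc.algebraMap_C, ← map_sub]
  exact RatFunc.algebraMap_ne_zero (Polynomial.X_sub_C_ne_zero r)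

theorem ratFunc_algEquiv_eq_of_X {F : Type*} [Field F] {σ τ : RatFunc F ≃ₐ[F] RatFunc F}
    (h : σ RatFunc.X = τ RatFunc.X) : σ = τ := by
  have hp : (σ : RatFunc F →ₐ[F] RatFunc F).comp (IsScalarTower.toAlgHom F F[X] (RatFunc F)) =
      (τ : RatFunc F →ₐ[F] RatFunc F).comp (IsScalarTower.toAlgHom F F[X] (RatFunc F)) := by
    apply Polynomial.algHom_ext
    simpa using h
  ext y
  induction y using RatFunc.induction_on with
  | f p q hq =>
    have e := fun p => DFunLike.congr_fun hp p
    change ∀ p : F[X], σ (algebraMap F[X] _ p) = τ (algebraMap F[X] _ p) at e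
    rw [map_div₀, map_div₀, e, e]

theorem centralizerValue_step {F : Type*} [Field F] {a b : F} (hb : b ≠ 0)
    (σ : RatFunc F ≃ₐ[F] RatFunc F)
    (hσ : σ RatFunc.X = 1 / (-(RatFunc.C b) * RatFunc.X - RatFunc.C a)) (o : Option F) :
    ∃ o', σ (centralizerValue a b o) = centralizerValue a b o' := by
  have hC : ∀ c : F, σ (RatFunc.C c) = RatFunc.C c := fun c => by
    simpa [RatFunc.algebraMap_eq_C] using σ.commutes c
  have hb' : (RatFunc.C b : RatFunc F) ≠ 0 := by simpa using hb
  have hpole : ∀ r : F, (RatFunc.X - RatFunc.C r : RatFunc F) ≠ 0 := ratFunc_X_sub_C_ne_zero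
  have hden : (-(RatFunc.C b) * RatFunc.X - RatFunc.C a : RatFunc F) ≠ 0 := by
    have : (-(RatFunc.C b) * RatFunc.X - RatFunc.C a : RatFunc F) =
        -(RatFunc.C b) * (RatFunc.X - RatFunc.C (-a / b)) := by
      rw [map_div₀, map_neg]; field_simp; ring
    rw [this]
    exact mul_ne_zero (neg_ne_zero.mpr hb') (hpole _)
  obtain ⟨D, hD⟩ : ∃ D : RatFunc F, D = -(RatFunc.C b) * RatFunc.X - RatFunc.C a := ⟨_, rfl⟩
  have hX : (RatFunc.X : RatFunc F) = -(D + RatFunc.C a) / RatFunc.C b := by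
    rw [hD]; field_simp; ring
  rw [← hD] at hσ hden
  cases o with
  | none =>
    refine ⟨some (-a / b), ?_⟩
    have h0 : a + b * (-a / b) = 0 := by field_simp; ring
    have h1 := hpole (-a / b)
    simp only [centralizerValue, hσ, h0, hD]
    simp only [map_neg, map_div₀, map_zero] at h1 ⊢
    congr 1
    · ring
    · field_simp; ring
  | some r =>
    by_cases hr : r = 0
    · refine ⟨none, ?_⟩
      simp only [centralizerValue, hσ, hr, map_div₀, map_mul, map_add, map_sub, hC, map_one,
        map_zero, map_neg]
      rw [hX]
      field_simp
      ring
    · refine ⟨some (-a / b - 1 / (b * r)), ?_⟩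
      have hr' : (RatFunc.C r : RatFunc F) ≠ 0 := by simpa using hr
      have h1 := hpole (-a / b - 1 / (b * r))
      have h2 : 1 / D - RatFunc.C r ≠ 0 := by
        rw [← hσ, ← hC r, ← map_sub]
        exact (map_ne_zero σ).mpr (hpole r)
      simp only [centralizerValue, hσ, map_div₀, map_mul, map_add, map_sub, hC, map_one,
        map_neg] at h1 h2 ⊢
      rw [div_eq_div_iff (mul_ne_zero (neg_ne_zero.mpr hb') h2)
        (mul_ne_zero (neg_ne_zero.mpr hb') h1), hX]
      field_simp
      ring

theorem exists_pow_apply_X_eq {F : Type*} [Field F] {a b : F} (hb : b ≠ 0)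
    (σ : RatFunc F ≃ₐ[F] RatFunc F)
    (hσ : σ RatFunc.X = 1 / (-(RatFunc.C b) * RatFunc.X - RatFunc.C a)) (n : ℕ) :
    ∃ o, (σ ^ n) RatFunc.X = centralizerValue a b o := by
  induction n with
  | zero => exact ⟨none, by simp [centralizerValue]⟩
  | succ n ih =>
    obtain ⟨o, ho⟩ := ih
    rw [pow_succ', AlgEquiv.mul_apply, ho]
    exact centralizerValue_step hb σ hσ o

/-- When `σ` has order `q + 1`, the group `⟨σ⟩` is indexed by the projective line over `F`. -/
theorem exists_bijective_centralizerValue {F : Type*} [Field F] [Fintype F] {a b : F} (hb : b ≠ 0)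
    (σ : RatFunc F ≃ₐ[F] RatFunc F)
    (hσ : σ RatFunc.X = 1 / (-(RatFunc.C b) * RatFunc.X - RatFunc.C a))
    (horder : orderOf σ = Fintype.card F + 1) [Fintype (Subgroup.zpowers σ)] :
    ∃ g : Subgroup.zpowers σ → Option F, Function.Bijective g ∧
      ∀ τ : Subgroup.zpowers σ, (τ : RatFunc F ≃ₐ[F] RatFunc F) RatFunc.X = centralizerValue a b (g τ) := by
  have hfin : IsOfFinOrder σ := orderOf_pos_iff.mp (by omega)
  have h : ∀ τ : Subgroup.zpowers σ, ∃ o,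
      (τ : RatFunc F ≃ₐ[F] RatFunc F) RatFunc.X = centralizerValue a b o := by
    rintro ⟨τ, hτ⟩
    obtain ⟨n, rfl⟩ := hfin.mem_powers_iff_mem_zpowers.mpr hτ
    exact exists_pow_apply_X_eq hb σ hσ n
  choose g hg using h
  refine ⟨g, (Fintype.bijective_iff_injective_and_card g).mpr ⟨fun τ τ' e => ?_, ?_⟩, hg⟩
  · exact Subtype.ext (ratFunc_algEquiv_eq_of_X (by rw [hg, hg, e]))
  · rw [← Nat.card_eq_fintype_card, Nat.card_zpowers, horder, Fintype.card_option]

theorem ratFunc_prod_X_sub_C_eq (F : Type*) [Field F] [Fintype F] :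
    ∏ r : F, (RatFunc.X - RatFunc.C r : RatFunc F) =
      RatFunc.X ^ Fintype.card F - RatFunc.X := by
  have h : ∏ r : F, (X - C r) = X ^ Fintype.card F - X := by
    have hcard := FiniteField.X_pow_card_sub_X_natDegree_eq F (Fintype.one_lt_card (α := F))
    have hprod := prod_multiset_X_sub_C_of_monic_of_roots_card_eq
      (p := (X ^ Fintype.card F - X : F[X]))
      (monic_X_pow_sub (by rw [degree_X]; exact_mod_cast Fintype.one_lt_card (α := F)))
      (by rw [FiniteField.roots_X_pow_card_sub_X, hcard]; rfl)
    rwa [FiniteField.roots_X_pow_card_sub_X] at hprod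
  simpa [map_prod] using congrArg (algebraMap F[X] (RatFunc F)) h

/-- The sum of the images of `X` over the projective line is `u / (X ^ q - X)` with `u` of degree
`q + 1`. -/
theorem exists_natDegree_sum_centralizerValue {F : Type*} [Field F] [Fintype F] {a b : F}
    (hb : b ≠ 0) : ∃ u : F[X], u.natDegree = Fintype.card F + 1 ∧
      ∑ o, centralizerValue a b o =
        algebraMap F[X] (RatFunc F) u / (RatFunc.X ^ Fintype.card F - RatFunc.X) := by
  classical
  have hdeg : (X * ∏ r : F, (X - C r) : F[X]).natDegree = Fintype.card F + 1 := by
    rw [monic_X.natDegree_mul (monic_prod_of_monic _ _ fun r _ => monic_X_sub_C r),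
      natDegree_prod_of_monic _ _ fun r _ => monic_X_sub_C r]
    simp [add_comm]
  have hterm : ∀ r : F, (C (-b⁻¹) * (C (a + b * r) * X + 1) *
      ∏ s ∈ Finset.univ.erase r, (X - C s) : F[X]).natDegree ≤ Fintype.card F := by
    intro r
    have h1 : (C (-b⁻¹) * (C (a + b * r) * X + 1) : F[X]).natDegree ≤ 1 := by compute_degree
    have h2 : (∏ s ∈ Finset.univ.erase r, (X - C s) : F[X]).natDegree = Fintype.card F - 1 := by
      rw [natDegree_prod_of_monic _ _ fun r _ => monic_X_sub_C r]
      simp [Finset.card_erase_of_mem]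
    have h3 := Fintype.card_pos (α := F)
    exact natDegree_mul_le.trans (by omega)
  refine ⟨X * ∏ r : F, (X - C r) + ∑ r : F, C (-b⁻¹) * (C (a + b * r) * X + 1) *
    ∏ s ∈ Finset.univ.erase r, (X - C s), ?_, ?_⟩
  · rw [natDegree_add_eq_left_of_natDegree_lt, hdeg]
    rw [hdeg]
    exact Nat.lt_succ_of_le (natDegree_sum_le_of_forall_le _ _ fun r _ => hterm r)
  · have hne : (∏ r : F, (RatFunc.X - RatFunc.C r : RatFunc F)) ≠ 0 :=
      Finset.prod_ne_zero_iff.mpr fun r _ => ratFunc_X_sub_C_ne_zero r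
    have hb' : (RatFunc.C b : RatFunc F) ≠ 0 := by simpa using hb
    rw [← ratFunc_prod_X_sub_C_eq, eq_div_iff hne, Fintype.sum_option, add_mul, Finset.sum_mul]
    simp only [map_add, map_mul, map_sum, map_prod, map_sub, RatFunc.algebraMap_X,
      RatFunc.algebraMap_C, map_one, centralizerValue]
    congr 1
    refine Finset.sum_congr rfl fun r _ => ?_
    have hr := ratFunc_X_sub_C_ne_zero r
    rw [← Finset.mul_prod_erase Finset.univ _ (Finset.mem_univ r)]
    simp only [map_neg, map_inv₀]
    field_simp

theorem inv_aeval_centralizerValue {F : Type*} [Field F] {a b : F} (hb : b ≠ 0)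
    {r : F} {Q : F[X]}
    (hQ : Q = X ^ 2 + C (a / b) * X + C (1 / b)) :
    1 / aeval (centralizerValue a b (some r)) Q =
      (RatFunc.X - RatFunc.C r) ^ 2 /
        (RatFunc.C (((a + b * r) ^ 2 - a * (a + b * r) + b) / b ^ 2) *
          algebraMap F[X] (RatFunc F) Q) := by
  have hb' : (RatFunc.C b : RatFunc F) ≠ 0 := by simpa using hb
  have hX := ratFunc_X_sub_C_ne_zero r
  have key : aeval (centralizerValue a b (some r)) Q * (RatFunc.X - RatFunc.C r) ^ 2 =
      RatFunc.C (((a + b * r) ^ 2 - a * (a + b * r) + b) / b ^ 2) *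
        algebraMap F[X] (RatFunc F) Q := by
    simp only [hQ, map_add, map_mul, map_pow, aeval_X, aeval_C, RatFunc.algebraMap_X,
      RatFunc.algebraMap_C, RatFunc.algebraMap_eq_C, centralizerValue, map_div₀, map_sub,
      map_one, map_neg]
    field_simp
    ring
  rw [← key]
  by_cases h0 : aeval (centralizerValue a b (some r)) Q = 0
  · simp [h0]
  · field_simp

/-- **The generators for the full cyclic group `⟨σ⟩` of order `q+1`.**
With `σ` of order `q+1` from a primitive quadratic `m(X) = X² + aX + b` and
`Q(X) = X² + (a/b)X + 1/b`, there exist `u` of degree `q+1` and `c ≠ 0` with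
`Σ_{τ∈⟨σ⟩} τ(x) = u(x)/(x^q - x)` and
`∏_{τ∈⟨σ⟩} τ(1/Q(x)) = (x^q - x)²/(c·Q(x)^{q+1})`. -/
theorem generators_for_full_cyclic_group
    (Fq : Type*) [Field Fq] [Fintype Fq] (a b : Fq)
    (m : Polynomial Fq) (hm : m = X ^ 2 + C a * X + C b)
    (hirr : Irreducible m)
    (hprim : orderOf (AdjoinRoot.root m) = Fintype.card Fq ^ 2 - 1)
    (σ : RatFunc Fq ≃ₐ[Fq] RatFunc Fq)
    (hσ : σ RatFunc.X = 1 / (-(RatFunc.C b) * RatFunc.X - RatFunc.C a))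
    (horder : orderOf σ = Fintype.card Fq + 1)
    (Qp : Polynomial Fq) (hQ : Qp = X ^ 2 + C (a / b) * X + C (1 / b))
    (G : Subgroup (RatFunc Fq ≃ₐ[Fq] RatFunc Fq)) [Fintype G]
    (hG : G = Subgroup.zpowers σ) :
    ∃ (u : Polynomial Fq) (c : Fq),
      u.natDegree = Fintype.card Fq + 1 ∧ c ≠ 0 ∧
      (∑ τ : G, (τ : RatFunc Fq ≃ₐ[Fq] RatFunc Fq) RatFunc.X) =
        algebraMap (Polynomial Fq) (RatFunc Fq) u /
          (RatFunc.X ^ Fintype.card Fq - RatFunc.X) ∧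
      (∏ τ : G, (τ : RatFunc Fq ≃ₐ[Fq] RatFunc Fq)
          (1 / algebraMap (Polynomial Fq) (RatFunc Fq) Qp)) =
        (RatFunc.X ^ Fintype.card Fq - RatFunc.X) ^ 2 /
          (RatFunc.C c *
            algebraMap (Polynomial Fq) (RatFunc Fq) (Qp ^ (Fintype.card Fq + 1))) := by
  subst hG
  have hdet : ∀ t : Fq, t ^ 2 - a * t + b ≠ 0 := by
    intro t ht
    have h1 := degree_eq_one_of_irreducible_of_root hirr (x := -t)
      (by simp [hm, IsRoot.def]; linear_combination ht)
    have h2 : m.degree = 2 := by rw [hm]; compute_degree!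
    rw [h2] at h1
    exact absurd h1 (by decide)
  have hb : b ≠ 0 := by simpa using hdet 0
  obtain ⟨g, hg, hgX⟩ := exists_bijective_centralizerValue hb σ hσ horder
  obtain ⟨u, hu, hsum⟩ := exists_natDegree_sum_centralizerValue (a := a) hb
  refine ⟨u, ∏ r : Fq, ((a + b * r) ^ 2 - a * (a + b * r) + b) / b ^ 2, hu,
    Finset.prod_ne_zero_iff.mpr fun r _ => div_ne_zero (hdet _) (pow_ne_zero 2 hb), ?_, ?_⟩
  · rw [← hsum]
    exact Fintype.sum_bijective g hg _ _ hgX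
  · have hval : ∀ τ : Subgroup.zpowers σ, (τ : RatFunc Fq ≃ₐ[Fq] RatFunc Fq)
        (1 / algebraMap Fq[X] (RatFunc Fq) Qp) =
          1 / aeval (centralizerValue a b (g τ)) Qp := by
      intro τ
      rw [map_div₀, map_one, ← hgX, ← RatFunc.algebraMap_X, aeval_algEquiv, AlgHom.comp_apply,
        aeval_algebraMap_apply, aeval_X_left_apply]
      rfl
    rw [Fintype.prod_bijective g hg _ (fun o => 1 / aeval (centralizerValue a b o) Qp) hval,
      Fintype.prod_option]
    simp only [inv_aeval_centralizerValue hb hQ]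
    rw [Finset.prod_div_distrib, Finset.prod_pow, ratFunc_prod_X_sub_C_eq,
      Finset.prod_mul_distrib, Finset.prod_const, Finset.card_univ, ← map_prod, centralizerValue,
      ← RatFunc.algebraMap_X, aeval_algebraMap_apply, aeval_X_left_apply, map_pow, pow_succ]
    rw [div_mul_div_comm, one_mul]
    congr 1
    ring
end

section
/- Let n = p_1 p_2 ⋯ p_r be a divisor of q+1 and let {1} = G_0 < G_1 < ⋯ < G_r = G be an ascending chain of subgroups of ⟨σ⟩ with |G_i| = p_1⋯p_i. For 0 ≤ i ≤ r set x_i = Σ_{τ∈G_i} τ(x) (so x_0 = x), and set y_r = ∏_{τ∈G_r} τ(1/Q(x)). Suppose that for each 1 ≤ i ≤ r there are pairwise distinct elements λ_{i,1},…,λ_{i,p_i−1} ∈ 𝔽_q and a polynomial u_i ∈ 𝔽_q[T] of degree p_i with x_i = u_i(x_{i−1}) / ∏_{k=1}^{p_i−1}(x_{i−1} − λ_{i,k}) in 𝔽_q(x). For 0 ≤ i ≤ r−1 define z_i^{(0)} = 1 and z_i^{(e)} = 1/∏_{k=1}^{e}(x_i − λ_{i+1,k}) for 1 ≤ e ≤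 p_{i+1}−1; also set z_r^{(0)} = 1 and z_r^{(1)} = x_r. Then the set { z_0^{(e_0)} z_1^{(e_1)} ⋯ z_{r−1}^{(e_{r−1})} z_r^{(e_r)} · y_r : 0 ≤ e_i ≤ p_{i+1}−1 for 0 ≤ i ≤ r−1, e_r ∈ {0,1} } together with the constant function 1 is an 𝔽_q-basis of the 𝔽_q-subspace L(nQ) = { g(x)/Q(x)^n : g ∈ 𝔽_q[X], deg g ≤ 2n } of 𝔽_q(x). -/
open Polynomial

section PolynomialLemmas

variable {K : Type*} [Field K]

theorem natDegree_sub_C_mul_of_natDegree_eq_succ {f D : K[X]}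
    (hdeg : f.natDegree = D.natDegree + 1) (l : K) :
    (f - C l * D).natDegree = f.natDegree := by
  apply natDegree_sub_eq_left_of_natDegree_lt
  have := natDegree_C_mul_le l D
  omega

theorem isCoprime_sub_C_mul_left {f D : K[X]} (h : IsCoprime f D) (l : K) :
    IsCoprime (f - C l * D) D := by
  have := IsCoprime.add_mul_right_left h (-C l)
  rwa [neg_mul, ← sub_eq_add_neg] at this

/-- The coefficients of a mixed-radix expansion in `D` and the `E k` are determined to be zero
when they have small degree. -/
theorem eq_zero_of_sum_mul_pow_mul_prod_eq_zero {D : K[X]} (E A : ℕ → K[X])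
    (hcop : ∀ k, IsCoprime (E k) D) (q : ℕ)
    (hdeg : ∀ e k, (A e).natDegree < (E k).natDegree)
    (h : ∑ e ∈ Finset.range (q + 1), A e * (D ^ e * ∏ k ∈ Finset.Ico e q, E k) = 0) :
    ∀ e ≤ q, A e = 0 := by
  induction q with
  | zero =>
    intro e he
    obtain rfl : e = 0 := by omega
    simpa using h
  | succ q ih =>
    have hfac : ∑ e ∈ Finset.range (q + 1), A e * (D ^ e * ∏ k ∈ Finset.Ico e (q + 1), E k) =
        E q * ∑ e ∈ Finset.range (q + 1), A e * (D ^ e * ∏ k ∈ Finset.Ico e q, E k) := by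
      rw [Finset.mul_sum]
      refine Finset.sum_congr rfl fun e he => ?_
      rw [Finset.prod_Ico_succ_top (by simpa [Nat.lt_succ_iff] using he)]
      ring
    rw [Finset.sum_range_succ, hfac, Finset.Ico_self, Finset.prod_empty, mul_one] at h
    have hdvd : E q ∣ A (q + 1) * D ^ (q + 1) := by
      rw [add_comm] at h
      rw [eq_neg_of_add_eq_zero_left h]
      exact (dvd_mul_right _ _).neg_right
    have htop : A (q + 1) = 0 :=
      eq_zero_of_dvd_of_natDegree_lt ((hcop q).pow_right.dvd_of_dvd_mul_right hdvd) (hdeg _ _)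
    have hE : E q ≠ 0 := by
      intro h0
      have := hdeg 0 q
      simp [h0] at this
    rw [htop, zero_mul, add_zero] at h
    intro e he
    rcases Nat.lt_or_ge q e with hlt | hle
    · obtain rfl : e = q + 1 := by omega
      exact htop
    · exact ih ((mul_eq_zero.mp h).resolve_left hE) e hle

/-- If two reduced fractions satisfy `f' / D' = u(f / D) / ∏ (f / D - l k)` with matching
degrees, then `D'` is the obvious denominator up to a constant. -/
theorem exists_denominator_eq_C_mul {f D f' D' u : K[X]} {p : ℕ} (hp : 0 < p) (l : ℕ → K)
    (hu : u.natDegree = p) (hD : D ≠ 0) (hD' : D' ≠ 0)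
    (hdeg : f.natDegree = D.natDegree + 1)
    (hdeg' : D'.natDegree + 1 = p * (D.natDegree + 1))
    (hcop' : IsCoprime f' D')
    (h : algebraMap K[X] (RatFunc K) f' / algebraMap K[X] (RatFunc K) D' =
      aeval (algebraMap K[X] (RatFunc K) f / algebraMap K[X] (RatFunc K) D) u /
        ∏ k ∈ Finset.range (p - 1),
          (algebraMap K[X] (RatFunc K) f / algebraMap K[X] (RatFunc K) D - RatFunc.C (l k))) :
    ∃ c : K, c ≠ 0 ∧ D * ∏ k ∈ Finset.range (p - 1), (f - C (l k) * D) = C c * D' := by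
  have inj := RatFunc.algebraMap_injective K
  have hDr : algebraMap K[X] (RatFunc K) D ≠ 0 := by simpa using hD
  have hD'r : algebraMap K[X] (RatFunc K) D' ≠ 0 := by simpa using hD'
  have hEdeg : ∀ k, (f - C (l k) * D).natDegree = D.natDegree + 1 := fun k => by
    rw [natDegree_sub_C_mul_of_natDegree_eq_succ hdeg, hdeg]
  have hE0 : ∀ k, f - C (l k) * D ≠ 0 := fun k h0 => by
    have := hEdeg k
    simp [h0] at this
  set F := D * ∏ k ∈ Finset.range (p - 1), (f - C (l k) * D) with hF
  have hF0 : F ≠ 0 := mul_ne_zero hD (Finset.prod_ne_zero_iff.mpr fun k _ => hE0 k)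
  have hFdeg : F.natDegree = D'.natDegree := by
    rw [hF, natDegree_mul hD (Finset.prod_ne_zero_iff.mpr fun k _ => hE0 k),
      natDegree_prod _ _ fun k _ => hE0 k, Finset.sum_congr rfl fun k _ => hEdeg k,
      Finset.sum_const, Finset.card_range, smul_eq_mul]
    obtain ⟨q, rfl⟩ : ∃ q, p = q + 1 := ⟨p - 1, by omega⟩
    simp only [Nat.add_sub_cancel]
    linarith
  set U : K[X] := ∑ j ∈ Finset.range (p + 1), C (u.coeff j) * (f ^ j * D ^ (p - j)) with hU
  have hUr : aeval (algebraMap K[X] (RatFunc K) f / algebraMap K[X] (RatFunc K) D) u *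
      algebraMap K[X] (RatFunc K) D ^ p = algebraMap K[X] (RatFunc K) U := by
    rw [aeval_eq_sum_range' (n := p + 1) (by omega), hU, map_sum, Finset.sum_mul]
    refine Finset.sum_congr rfl fun j hj => ?_
    have hj' : j ≤ p := by simpa [Nat.lt_succ_iff] using hj
    rw [map_mul, map_mul, map_pow, map_pow, RatFunc.algebraMap_C, Algebra.smul_def,
      RatFunc.algebraMap_eq_C, div_pow, ← pow_sub_mul_pow _ hj']
    field_simp
  have hprod : (∏ k ∈ Finset.range (p - 1),
      (algebraMap K[X] (RatFunc K) f / algebraMap K[X] (RatFunc K) D - RatFunc.C (l k))) *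
        algebraMap K[X] (RatFunc K) D ^ p = algebraMap K[X] (RatFunc K) F := by
    obtain ⟨q, rfl⟩ : ∃ q, p = q + 1 := ⟨p - 1, by omega⟩
    have hk : ∀ k, algebraMap K[X] (RatFunc K) (f - C (l k) * D) =
        (algebraMap K[X] (RatFunc K) f / algebraMap K[X] (RatFunc K) D - RatFunc.C (l k)) *
          algebraMap K[X] (RatFunc K) D := fun k => by
      rw [map_sub, map_mul, RatFunc.algebraMap_C]
      field_simp
    rw [hF, map_mul, map_prod, Finset.prod_congr rfl fun k _ => hk k, Finset.prod_mul_distrib]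
    simp only [Nat.add_sub_cancel, Finset.prod_const, Finset.card_range]
    ring
  have hFr : algebraMap K[X] (RatFunc K) F ≠ 0 := by simpa using hF0
  have hpoly : f' * F = U * D' := by
    apply inj
    have hfrac : algebraMap K[X] (RatFunc K) f' / algebraMap K[X] (RatFunc K) D' =
        algebraMap K[X] (RatFunc K) U / algebraMap K[X] (RatFunc K) F := by
      rw [h, ← hUr, ← hprod, mul_div_mul_right _ _ (pow_ne_zero p hDr)]
    rw [div_eq_div_iff hD'r hFr] at hfrac
    simpa only [map_mul] using hfrac
  have hdvd : D' ∣ F := hcop'.symm.dvd_of_dvd_mul_left ⟨U, by rw [hpoly, mul_comm]⟩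
  obtain ⟨w, hw⟩ := hdvd
  have hw0 : w ≠ 0 := by
    rintro rfl
    exact hF0 (by simpa using hw)
  have hwdeg : w.natDegree = 0 := by
    have := hFdeg
    rw [hw, natDegree_mul hD' hw0] at this
    omega
  rw [natDegree_eq_zero] at hwdeg
  obtain ⟨c, rfl⟩ := hwdeg
  exact ⟨c, by simpa using hw0, by rw [hw, mul_comm]⟩

/-- In a tower `f (i + 1) / D (i + 1) = u(f i / D i) / ∏ (f i / D i - lam i k)` of reduced
fractions, the products of the partial inverses `∏_{k < e i} (f i / D i - lam i k)⁻¹`, multiplied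
by the last denominator, are linearly independent polynomials of bounded degree. -/
theorem exists_linearIndependent_numerators (r : ℕ) (p : Fin r → ℕ) (hp : ∀ i, 0 < p i)
    (f D : Fin (r + 1) → K[X]) (lam : Fin r → ℕ → K) (c : Fin r → K) (hc : ∀ i, c i ≠ 0)
    (hD : ∀ i, D i ≠ 0) (hdeg : ∀ i, (f i).natDegree = (D i).natDegree + 1)
    (hcop : ∀ i, IsCoprime (f i) (D i))
    (hrel : ∀ i : Fin r, D i.castSucc * ∏ k ∈ Finset.range (p i - 1),
      (f i.castSucc - C (lam i k) * D i.castSucc) = C (c i) * D i.succ) :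
    ∃ P : (∀ i, Fin (p i)) → K[X], LinearIndependent K P ∧
      (∀ e, (P e).natDegree ≤ (D (Fin.last r)).natDegree) ∧
      ∀ e, algebraMap K[X] (RatFunc K) (P e) =
        (∏ i : Fin r, (∏ k ∈ Finset.range (e i : ℕ),
          (algebraMap K[X] (RatFunc K) (f i.castSucc) / algebraMap K[X] (RatFunc K) (D i.castSucc)
            - RatFunc.C (lam i k)))⁻¹) * algebraMap K[X] (RatFunc K) (D (Fin.last r)) := by
  induction r with
  | zero =>
    refine ⟨fun _ => D 0, ?_, fun e => le_rfl, fun e => by simp⟩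
    rw [linearIndependent_unique_iff]
    exact hD 0
  | succ r ih =>
    obtain ⟨P, hPli, hPdeg, hP⟩ := ih (fun i => p i.castSucc) (fun i => hp _)
      (fun i => f i.castSucc) (fun i => D i.castSucc) (fun i => lam i.castSucc)
      (fun i => c i.castSucc) (fun i => hc _) (fun i => hD _) (fun i => hdeg _) (fun i => hcop _)
      (fun i => hrel i.castSucc)
    set L : Fin (r + 1) := Fin.last r
    set f₀ := f L.castSucc
    set D₀ := D L.castSucc with hD₀
    set E : ℕ → K[X] := fun k => f₀ - C (lam L k) * D₀ with hE
    obtain ⟨q, hq⟩ : ∃ q, p L = q + 1 := ⟨p L - 1, by have := hp L; omega⟩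
    have hEdeg : ∀ k, (E k).natDegree = D₀.natDegree + 1 := fun k => by
      simp only [hE]
      rw [natDegree_sub_C_mul_of_natDegree_eq_succ (hdeg _), hdeg]
    have hE0 : ∀ k, E k ≠ 0 := fun k h0 => by
      have := hEdeg k
      simp [h0] at this
    have hEcop : ∀ k, IsCoprime (E k) D₀ := fun k => isCoprime_sub_C_mul_left (hcop _) _
    have hrelL : D₀ * ∏ k ∈ Finset.range q, E k = C (c L) * D L.succ := by
      have := hrel L
      rwa [hq] at this
    have hDeg : (D L.succ).natDegree = D₀.natDegree + q * (D₀.natDegree + 1) := by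
      rw [← natDegree_C_mul (hc L), ← hrelL,
        natDegree_mul (hD _) (Finset.prod_ne_zero_iff.mpr fun k _ => hE0 k),
        natDegree_prod _ _ fun k _ => hE0 k, Finset.sum_congr rfl fun k _ => hEdeg k]
      simp [hD₀]
    refine ⟨fun e => C (c L)⁻¹ * (P (fun i => e i.castSucc) *
      (D₀ ^ (e L : ℕ) * ∏ k ∈ Finset.Ico (e L : ℕ) q, E k)), ?_, ?_, ?_⟩
    · rw [Fintype.linearIndependent_iff]
      intro g hg
      rw [← (Fin.snocEquiv fun i => Fin (p i)).sum_comp, Fintype.sum_prod_type] at hg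
      set A : ℕ → K[X] := fun j => if hj : j < p L then
        ∑ e, g (Fin.snocEquiv (fun i => Fin (p i)) (⟨j, hj⟩, e)) • P e else 0 with hA
      have hAdeg : ∀ j, (A j).natDegree ≤ D₀.natDegree := fun j => by
        simp only [hA]
        split_ifs with hj
        · exact natDegree_sum_le_of_forall_le _ _ fun e _ =>
            (natDegree_smul_le _ _).trans (hPdeg e)
        · simp
      have hsum : ∑ j ∈ Finset.range (q + 1),
          A j * (D₀ ^ j * ∏ k ∈ Finset.Ico j q, E k) = 0 := by
        have hc' : (C (c L)⁻¹ : K[X]) ≠ 0 := by simpa using hc L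
        refine (mul_eq_zero.mp ?_).resolve_left hc'
        rw [← hg, ← hq, ← Fin.sum_univ_eq_sum_range
          (fun j => A j * (D₀ ^ j * ∏ k ∈ Finset.Ico j q, E k)), Finset.mul_sum]
        refine Finset.sum_congr rfl fun j _ => ?_
        simp only [hA, j.2, dif_pos, Fin.eta, Finset.sum_mul, Finset.mul_sum]
        refine Finset.sum_congr rfl fun e _ => ?_
        simp only [L, Fin.snocEquiv_apply, Fin.snoc_castSucc, Fin.snoc_last, smul_mul_assoc,
          mul_smul_comm]
      have hA0 := eq_zero_of_sum_mul_pow_mul_prod_eq_zero E A hEcop q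
        (fun e k => by have := hAdeg e; have := hEdeg k; omega) hsum
      intro e
      obtain ⟨⟨j, e'⟩, rfl⟩ := (Fin.snocEquiv fun i => Fin (p i)).surjective e
      have hjp : (j : ℕ) < p L := j.2
      have hj := hA0 j (by omega)
      simp only [hA, dif_pos hjp, Fin.eta] at hj
      exact Fintype.linearIndependent_iff.mp hPli _ hj e'
    · intro e
      have he : (e L : ℕ) ≤ q := by have := (e L).2; omega
      have h1 := hPdeg fun i => e i.castSucc
      have h2 : (∏ k ∈ Finset.Ico (e L : ℕ) q, E k).natDegree =
          (q - e L) * (D₀.natDegree + 1) := by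
        rw [natDegree_prod _ _ fun k _ => hE0 k, Finset.sum_congr rfl fun k _ => hEdeg k]
        simp
      have h3 : (D₀ ^ (e L : ℕ)).natDegree ≤ e L * D₀.natDegree := natDegree_pow_le
      have h4 : (q - e L) * (D₀.natDegree + 1) + e L * D₀.natDegree ≤
          q * (D₀.natDegree + 1) := by
        obtain ⟨t, rfl⟩ := Nat.exists_eq_add_of_le he
        rw [Nat.add_sub_cancel_left]
        nlinarith
      refine (natDegree_C_mul_le _ _).trans (natDegree_mul_le.trans ?_)
      have h5 := natDegree_mul_le (p := D₀ ^ (e L : ℕ)) (q := ∏ k ∈ Finset.Ico (e L : ℕ) q, E k)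
      change _ ≤ (D L.succ).natDegree
      omega
    · intro e
      have he : (e L : ℕ) ≤ q := by have := (e L).2; omega
      have hD₀r : algebraMap K[X] (RatFunc K) D₀ ≠ 0 := by simpa using hD L.castSucc
      have hcr : RatFunc.C (c L) ≠ 0 := by simpa using hc L
      have hEr : ∀ k, algebraMap K[X] (RatFunc K) (E k) ≠ 0 := fun k => by simpa using hE0 k
      have hz : ∏ k ∈ Finset.range (e L : ℕ), (algebraMap K[X] (RatFunc K) f₀ /
          algebraMap K[X] (RatFunc K) D₀ - RatFunc.C (lam L k)) =
          (∏ k ∈ Finset.range (e L : ℕ), algebraMap K[X] (RatFunc K) (E k)) /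
            algebraMap K[X] (RatFunc K) D₀ ^ (e L : ℕ) := by
        rw [eq_div_iff (pow_ne_zero _ hD₀r)]
        have hk : ∀ k, algebraMap K[X] (RatFunc K) (E k) =
            (algebraMap K[X] (RatFunc K) f₀ / algebraMap K[X] (RatFunc K) D₀
              - RatFunc.C (lam L k)) * algebraMap K[X] (RatFunc K) D₀ := fun k => by
          simp only [hE]
          rw [map_sub, map_mul, RatFunc.algebraMap_C]
          field_simp
        rw [Finset.prod_congr rfl fun k _ => hk k, Finset.prod_mul_distrib]
        simp
      have hDs : algebraMap K[X] (RatFunc K) (D (Fin.last (r + 1))) = (RatFunc.C (c L))⁻¹ *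
          (algebraMap K[X] (RatFunc K) D₀ *
            ((∏ k ∈ Finset.range (e L : ℕ), algebraMap K[X] (RatFunc K) (E k)) *
            ∏ k ∈ Finset.Ico (e L : ℕ) q, algebraMap K[X] (RatFunc K) (E k))) := by
        rw [Finset.prod_range_mul_prod_Ico _ he, ← map_prod, ← map_mul, hrelL, map_mul,
          RatFunc.algebraMap_C, inv_mul_cancel_left₀ hcr]
        rfl
      have hPe : algebraMap K[X] (RatFunc K) (P fun i => e i.castSucc) = _ := hP _
      rw [Fin.prod_univ_castSucc, hz, hDs, map_mul, map_mul, hPe, map_mul, map_pow, map_prod,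
        RatFunc.algebraMap_C, map_inv₀]
      have hprod0 : ∏ k ∈ Finset.range (e L : ℕ), algebraMap K[X] (RatFunc K) (E k) ≠ 0 :=
        Finset.prod_ne_zero_iff.mpr fun k _ => hEr k
      change _ * (_ * algebraMap K[X] (RatFunc K) D₀ * _) = _
      generalize ∏ i : Fin r, (∏ k ∈ Finset.range (e i.castSucc : ℕ),
        (algebraMap K[X] (RatFunc K) (f i.castSucc.castSucc) /
          algebraMap K[X] (RatFunc K) (D i.castSucc.castSucc)
            - RatFunc.C (lam i.castSucc k)))⁻¹ = Z
      simp only [L] at hprod0 ⊢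
      field_simp

end PolynomialLemmas

section Span

variable {K : Type*} [Field K]

/-- Multiples of two coprime polynomials `f`, `D` by linearly independent polynomials of
degree less than `deg f`, together with one polynomial of degree `2 * deg f`, form a basis of the
polynomials of degree at most `2 * deg f`. -/
theorem linearIndependent_and_span_eq_degreeLT {ι : Type*} [Fintype ι] {P : ι → K[X]}
    (hP : LinearIndependent K P) {f D R : K[X]} {n : ℕ} (hn : 0 < n) {c : K} (hc : c ≠ 0)
    (hcop : IsCoprime f D) (hf : f.natDegree = n) (hD : D.natDegree + 1 = n)
    (hPdeg : ∀ e, (P e).natDegree ≤ D.natDegree) (hcard : Fintype.card ι = n)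
    (hR : R.natDegree = 2 * n) :
    LinearIndependent K (fun o : Option (ι × Fin 2) =>
      o.elim R fun e => C c * (P e.1 * (f ^ (e.2 : ℕ) * D ^ (1 - (e.2 : ℕ))))) ∧
    Submodule.span K (Set.range fun o : Option (ι × Fin 2) =>
      o.elim R fun e => C c * (P e.1 * (f ^ (e.2 : ℕ) * D ^ (1 - (e.2 : ℕ))))) =
        degreeLT K (2 * n + 1) := by
  have hD0 : f ≠ 0 := by
    rintro rfl
    simp at hf
    omega
  set T : ι × Fin 2 → K[X] := fun e => C c * (P e.1 * (f ^ (e.2 : ℕ) * D ^ (1 - (e.2 : ℕ))))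
    with hT
  have hTdeg : ∀ e, (T e).natDegree ≤ 2 * n - 1 := by
    rintro ⟨e, ε⟩
    have h1 := hPdeg e
    refine (natDegree_C_mul_le _ _).trans (natDegree_mul_le.trans ?_)
    have h2 : (f ^ (ε : ℕ) * D ^ (1 - (ε : ℕ))).natDegree ≤ n := by
      fin_cases ε
      · simp
        omega
      · simp [hf]
    simp only
    omega
  have hTli : LinearIndependent K T := by
    rw [Fintype.linearIndependent_iff]
    intro g hg
    have hsplit : C c * ((∑ e, g (e, 0) • P e) * D + (∑ e, g (e, 1) • P e) * f) = 0 := by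
      rw [← hg, Fintype.sum_prod_type]
      simp only [hT, Fin.sum_univ_two, Finset.sum_add_distrib, mul_add, Finset.sum_mul,
        Finset.mul_sum]
      simp [mul_comm]
    have hsplit' := (mul_eq_zero.mp hsplit).resolve_left (by simpa using hc)
    have hA : ∑ e, g (e, 0) • P e = 0 := by
      refine eq_zero_of_dvd_of_natDegree_lt (p := f) (hcop.dvd_of_dvd_mul_right ?_) ?_
      · rw [eq_neg_of_add_eq_zero_left hsplit']
        exact (dvd_mul_left _ _).neg_right
      · have := natDegree_sum_le_of_forall_le Finset.univ (fun e => g (e, 0) • P e)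
          (n := D.natDegree) fun e _ => (natDegree_smul_le _ _).trans (hPdeg e)
        omega
    rw [hA, zero_mul, zero_add] at hsplit'
    have hB := (mul_eq_zero.mp hsplit').resolve_right hD0
    rintro ⟨e, ε⟩
    fin_cases ε
    · exact Fintype.linearIndependent_iff.mp hP _ hA e
    · exact Fintype.linearIndependent_iff.mp hP _ hB e
  have hspan : Submodule.span K (Set.range T) ≤ degreeLT K (2 * n) := by
    rw [Submodule.span_le]
    rintro _ ⟨e, rfl⟩
    rw [SetLike.mem_coe, mem_degreeLT]
    refine degree_le_natDegree.trans_lt ?_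
    have := hTdeg e
    exact_mod_cast (by omega : (T e).natDegree < 2 * n)
  have hRnot : R ∉ Submodule.span K (Set.range T) := fun h => by
    have h1 := mem_degreeLT.mp (hspan h)
    rw [degree_eq_natDegree (by rintro rfl; simp at hR; omega), hR] at h1
    exact lt_irrefl _ h1
  have hli : LinearIndependent K (fun o : Option (ι × Fin 2) => o.elim R T) := by
    have heq : (fun o : Option (ι × Fin 2) => o.elim R T) = fun o => o.casesOn' R T := by
      funext o
      cases o <;> rfl
    rw [heq]
    exact hTli.option hRnot
  refine ⟨hli, ?_⟩
  have : Module.Finite K (degreeLT K (2 * n + 1)) :=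
    Module.Finite.equiv (degreeLTEquiv K (2 * n + 1)).symm
  apply Submodule.eq_of_le_of_finrank_eq
  · rw [Submodule.span_le]
    rintro _ ⟨o, rfl⟩
    rw [SetLike.mem_coe, mem_degreeLT]
    refine degree_le_natDegree.trans_lt ?_
    have : (o.elim R T).natDegree < 2 * n + 1 := by
      cases o with
      | none => simp [hR]
      | some e => have := hTdeg e; simp only [Option.elim_some]; omega
    exact_mod_cast this
  · rw [finrank_span_eq_card hli, (degreeLTEquiv K (2 * n + 1)).finrank_eq]
    simp [hcard, mul_comm]

end Span

section Mobius

variable {K : Type*} [Field K] {a b : K}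

theorem ratFunc_linear_ne_zero {s t : K} (h : s ≠ 0 ∨ t ≠ 0) :
    RatFunc.C s * RatFunc.X + RatFunc.C t ≠ 0 := by
  rw [← RatFunc.algebraMap_C, ← RatFunc.algebraMap_C, ← RatFunc.algebraMap_X, ← map_mul,
    ← map_add]
  intro h0
  have h1 : C s * X + C t = 0 := RatFunc.algebraMap_injective K (by simpa using h0)
  have hs : s = 0 := by simpa using congrArg (fun g => coeff g 1) h1
  have ht : t = 0 := by simpa using congrArg (fun g => coeff g 0) h1
  tauto

theorem ratFunc_X_sub_C_ne_zero_s13 (t : K) : RatFunc.X - RatFunc.C t ≠ 0 := by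
  simpa [sub_eq_add_neg] using ratFunc_linear_ne_zero (s := 1) (t := -t) (Or.inl one_ne_zero)

theorem ratFuncAlgEquiv_apply_C (τ : RatFunc K ≃ₐ[K] RatFunc K) (s : K) :
    τ (RatFunc.C s) = RatFunc.C s := by
  rw [← RatFunc.algebraMap_eq_C]
  exact τ.commutes s

theorem ratFuncAlgEquiv_ext {τ τ' : RatFunc K ≃ₐ[K] RatFunc K}
    (h : τ RatFunc.X = τ' RatFunc.X) : τ = τ' := by
  have : (τ : RatFunc K →ₐ[K] RatFunc K) = τ' := by
    apply IsLocalization.algHom_ext (nonZeroDivisors K[X])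
    apply Polynomial.algHom_ext
    change τ (algebraMap K[X] (RatFunc K) X) = τ' (algebraMap K[X] (RatFunc K) X)
    rwa [RatFunc.algebraMap_X]
  exact AlgEquiv.ext fun w => DFunLike.congr_fun this w

/-- The powers of `σ` are the Möbius transformations with matrix in `K[A]`, where `A` is the
matrix of `σ`. -/
theorem exists_pow_apply_X (hb : b ≠ 0) {σ : RatFunc K ≃ₐ[K] RatFunc K}
    (hσ : σ RatFunc.X = 1 / (-(RatFunc.C b) * RatFunc.X - RatFunc.C a)) (k : ℕ) :
    ∃ s t : K, (s ≠ 0 ∨ t ≠ 0) ∧ (σ ^ k) RatFunc.X =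
      (RatFunc.C s * RatFunc.X + RatFunc.C t) /
        (RatFunc.C (-b * t) * RatFunc.X + RatFunc.C (s - a * t)) := by
  induction k with
  | zero => exact ⟨1, 0, by simp⟩
  | succ k ih =>
    obtain ⟨s, t, hst, hk⟩ := ih
    have hden : ∀ s t : K, (s ≠ 0 ∨ t ≠ 0) → (-b * t ≠ 0 ∨ s - a * t ≠ 0) := by
      intro s t hst
      by_contra! h
      obtain rfl : t = 0 := by simpa [hb] using h.1
      simp_all
    refine ⟨-b * t, s - a * t, hden s t hst, ?_⟩
    have hw := ratFunc_linear_ne_zero (s := -b) (t := -a) (Or.inl (neg_ne_zero.mpr hb))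
    have hw' : -(RatFunc.C b) * RatFunc.X - RatFunc.C a ≠ 0 := by
      simpa [sub_eq_add_neg] using hw
    rw [pow_succ', AlgEquiv.mul_apply, hk]
    simp only [map_div₀, map_add, map_mul, ratFuncAlgEquiv_apply_C, hσ]
    have hnum : RatFunc.C s * (1 / (-(RatFunc.C b) * RatFunc.X - RatFunc.C a)) + RatFunc.C t =
        (RatFunc.C (-b) * RatFunc.C t * RatFunc.X + RatFunc.C (s - a * t)) /
          (-(RatFunc.C b) * RatFunc.X - RatFunc.C a) := by
      rw [eq_div_iff hw', add_mul, mul_assoc, one_div, inv_mul_cancel₀ hw']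
      simp only [map_neg, map_sub, map_mul]
      ring
    have hdenom : RatFunc.C (-b) * RatFunc.C t *
        (1 / (-(RatFunc.C b) * RatFunc.X - RatFunc.C a)) + RatFunc.C (s - a * t) =
        (RatFunc.C (-b) * RatFunc.C (s - a * t) * RatFunc.X +
          RatFunc.C (-b * t - a * (s - a * t))) /
          (-(RatFunc.C b) * RatFunc.X - RatFunc.C a) := by
      rw [eq_div_iff hw', add_mul, mul_assoc, one_div, inv_mul_cancel₀ hw']
      simp only [map_neg, map_sub, map_mul]
      ring
    rw [hnum, hdenom, div_div_div_cancel_right₀ hw']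

/-- A nontrivial element of `⟨σ⟩` is determined by the finite pole `α` of its value at `x`. -/
theorem exists_apply_X_eq_of_mem_zpowers (hb : b ≠ 0) {σ : RatFunc K ≃ₐ[K] RatFunc K}
    (hσ : σ RatFunc.X = 1 / (-(RatFunc.C b) * RatFunc.X - RatFunc.C a)) (hfin : IsOfFinOrder σ)
    {τ : RatFunc K ≃ₐ[K] RatFunc K} (hτ : τ ∈ Subgroup.zpowers σ) (h1 : τ ≠ 1) :
    ∃ α : K, τ RatFunc.X = -((RatFunc.C (b * α + a) * RatFunc.X + 1) /
      (RatFunc.C b * (RatFunc.X - RatFunc.C α))) := by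
  obtain ⟨k, rfl⟩ := hfin.mem_powers_iff_mem_zpowers.mpr hτ
  obtain ⟨s, t, hst, hk⟩ := exists_pow_apply_X hb hσ k
  simp only at h1 ⊢
  have ht : t ≠ 0 := by
    rintro rfl
    have hs : RatFunc.C s ≠ 0 := by simpa using hst
    apply h1
    apply ratFuncAlgEquiv_ext
    rw [hk]
    simp [hs]
  refine ⟨(s / t - a) / b, ?_⟩
  have htr : RatFunc.C t ≠ 0 := by simpa using ht
  have hbr : RatFunc.C b ≠ 0 := by simpa using hb
  have hnum : RatFunc.C s * RatFunc.X + RatFunc.C t =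
      (RatFunc.C (b * ((s / t - a) / b) + a) * RatFunc.X + 1) * RatFunc.C t := by
    rw [mul_div_cancel₀ _ hb, sub_add_cancel, map_div₀]
    field_simp
  have hden : RatFunc.C (-b * t) * RatFunc.X + RatFunc.C (s - a * t) =
      -(RatFunc.C b * (RatFunc.X - RatFunc.C ((s / t - a) / b))) * RatFunc.C t := by
    simp only [map_div₀, map_mul, map_sub, map_neg]
    field_simp
    ring
  rw [hk, hnum, hden, mul_div_mul_right _ _ htr, div_neg]

/-- The effect on `1 / Q` of a transformation in `⟨σ⟩` whose value at `x` has the pole `α`. -/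
theorem apply_one_div_of_apply_X_eq (hb : b ≠ 0) {τ : RatFunc K ≃ₐ[K] RatFunc K} {α : K}
    (hτ : τ RatFunc.X = -((RatFunc.C (b * α + a) * RatFunc.X + 1) /
      (RatFunc.C b * (RatFunc.X - RatFunc.C α)))) :
    τ (1 / algebraMap K[X] (RatFunc K) (X ^ 2 + C (a / b) * X + C (1 / b))) =
      RatFunc.C (α ^ 2 + a / b * α + 1 / b)⁻¹ * (RatFunc.X - RatFunc.C α) ^ 2 /
        algebraMap K[X] (RatFunc K) (X ^ 2 + C (a / b) * X + C (1 / b)) := by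
  have hbr : RatFunc.C b ≠ 0 := by simpa using hb
  have hα := ratFunc_X_sub_C_ne_zero_s13 α
  simp only [map_div₀, map_add, map_mul, map_pow, map_one, RatFunc.algebraMap_C,
    RatFunc.algebraMap_X, ratFuncAlgEquiv_apply_C, hτ, map_inv₀]
  rw [one_div, inv_mul_eq_div, div_div, inv_eq_iff_eq_inv, inv_div]
  generalize RatFunc.C a = a' at *
  generalize RatFunc.C b = b' at *
  generalize RatFunc.C α = α' at *
  generalize (RatFunc.X : RatFunc K) = x at *
  field_simp
  ring

/-- The trace of `x` and the norm of `1 / Q` over a finite subgroup of `⟨σ⟩`, in terms of the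
finite points `S` of the orbit of infinity. -/
theorem exists_finset_sum_eq_and_prod_eq (hb : b ≠ 0) {σ : RatFunc K ≃ₐ[K] RatFunc K}
    (hσ : σ RatFunc.X = 1 / (-(RatFunc.C b) * RatFunc.X - RatFunc.C a)) (hfin : IsOfFinOrder σ)
    (H : Subgroup (RatFunc K ≃ₐ[K] RatFunc K)) [Fintype H] (hH : H ≤ Subgroup.zpowers σ) :
    ∃ S : Finset K, S.card + 1 = Fintype.card H ∧
      ∑ τ : H, (τ : RatFunc K ≃ₐ[K] RatFunc K) RatFunc.X =
        RatFunc.X + ∑ α ∈ S, -((RatFunc.C (b * α + a) * RatFunc.X + 1) /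
          (RatFunc.C b * (RatFunc.X - RatFunc.C α))) ∧
      ∏ τ : H, (τ : RatFunc K ≃ₐ[K] RatFunc K)
        (1 / algebraMap K[X] (RatFunc K) (X ^ 2 + C (a / b) * X + C (1 / b))) =
        1 / algebraMap K[X] (RatFunc K) (X ^ 2 + C (a / b) * X + C (1 / b)) *
          ∏ α ∈ S, (RatFunc.C (α ^ 2 + a / b * α + 1 / b)⁻¹ * (RatFunc.X - RatFunc.C α) ^ 2 /
            algebraMap K[X] (RatFunc K) (X ^ 2 + C (a / b) * X + C (1 / b))) := by
  classical
  have hex : ∀ τ : H, ∃ α : K, τ ≠ 1 → (τ : RatFunc K ≃ₐ[K] RatFunc K) RatFunc.X =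
      -((RatFunc.C (b * α + a) * RatFunc.X + 1) /
        (RatFunc.C b * (RatFunc.X - RatFunc.C α))) := fun τ => by
    by_cases h : τ = 1
    · exact ⟨0, fun h' => absurd h h'⟩
    · obtain ⟨α, hα⟩ := exists_apply_X_eq_of_mem_zpowers hb hσ hfin (hH τ.2) (by simpa using h)
      exact ⟨α, fun _ => hα⟩
  choose φ hφ using hex
  have hinj : Set.InjOn φ (Finset.univ.erase (1 : H)) := by
    intro τ hτ τ' hτ' h
    apply Subtype.ext
    apply ratFuncAlgEquiv_ext
    rw [hφ τ (by simpa using hτ), hφ τ' (by simpa using hτ'), h]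
  refine ⟨(Finset.univ.erase (1 : H)).image φ, ?_, ?_, ?_⟩
  · rw [Finset.card_image_of_injOn hinj, Finset.card_erase_add_one (Finset.mem_univ _),
      Finset.card_univ]
  · rw [Finset.sum_image hinj, ← Finset.add_sum_erase _ _ (Finset.mem_univ (1 : H))]
    congr 1
    exact Finset.sum_congr rfl fun τ hτ => hφ τ (Finset.ne_of_mem_erase hτ)
  · rw [Finset.prod_image hinj, ← Finset.mul_prod_erase _ _ (Finset.mem_univ (1 : H))]
    congr 1
    exact Finset.prod_congr rfl fun τ hτ =>
      apply_one_div_of_apply_X_eq hb (hφ τ (Finset.ne_of_mem_erase hτ))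

/-- The sum of `x` and simple fractions with poles in `S` is a reduced fraction with denominator
`∏ α ∈ S, (X - α)` and a numerator of degree `|S| + 1`. -/
theorem exists_reduced_fraction (hb : b ≠ 0) (hroot : ∀ α : K, b * α ^ 2 + a * α + 1 ≠ 0)
    (S : Finset K) :
    ∃ f : K[X], f.natDegree = S.card + 1 ∧ IsCoprime f (∏ α ∈ S, (X - C α)) ∧
      RatFunc.X + ∑ α ∈ S, -((RatFunc.C (b * α + a) * RatFunc.X + 1) /
          (RatFunc.C b * (RatFunc.X - RatFunc.C α))) =
        algebraMap K[X] (RatFunc K) f / algebraMap K[X] (RatFunc K) (∏ α ∈ S, (X - C α)) := by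
  classical
  have hdegprod : ∀ T : Finset K, (∏ α ∈ T, (X - C α)).natDegree = T.card := fun T => by
    simp
  set g : K → K[X] := fun α =>
    C b⁻¹ * ((C (b * α + a) * X + 1) * ∏ β ∈ S.erase α, (X - C β)) with hg
  have hbr : RatFunc.C b ≠ 0 := by simpa using hb
  refine ⟨X * ∏ α ∈ S, (X - C α) - ∑ α ∈ S, g α, ?_, ?_, ?_⟩
  · have h1 : (X * ∏ α ∈ S, (X - C α)).natDegree = S.card + 1 := by
      rw [natDegree_X_mul (Finset.prod_ne_zero_iff.mpr fun α _ => X_sub_C_ne_zero α), hdegprod]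
    rw [natDegree_sub_eq_left_of_natDegree_lt, h1]
    rw [h1, Nat.lt_succ_iff]
    refine natDegree_sum_le_of_forall_le _ _ fun α hα => ?_
    refine (natDegree_C_mul_le _ _).trans (natDegree_mul_le.trans ?_)
    rw [hdegprod, Finset.card_erase_of_mem hα]
    have h2 : (C (b * α + a) * X + 1 : K[X]).natDegree ≤ 1 := by
      rw [← C_1]
      exact natDegree_linear_le
    have := Finset.card_pos.mpr ⟨α, hα⟩
    omega
  · refine IsCoprime.prod_right fun α hα => ?_
    refine ((irreducible_X_sub_C α).coprime_iff_not_dvd.mpr ?_).symm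
    rw [dvd_iff_isRoot, IsRoot.def, eval_sub, eval_mul, eval_finsetSum]
    have hzero : eval α (∏ α ∈ S, (X - C α)) = 0 := by
      rw [eval_prod]
      exact Finset.prod_eq_zero hα (by simp)
    rw [hzero, mul_zero, zero_sub, neg_eq_zero, Finset.sum_eq_single_of_mem α hα]
    · simp only [hg, eval_mul, eval_C, eval_add, eval_X, eval_one, eval_prod, eval_sub]
      refine mul_ne_zero (inv_ne_zero hb) (mul_ne_zero ?_ ?_)
      · convert hroot α using 1
        ring
      · exact Finset.prod_ne_zero_iff.mpr fun β hβ =>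
          sub_ne_zero.mpr (Finset.ne_of_mem_erase hβ).symm
    · intro β _ hβα
      simp only [hg, eval_mul, eval_prod]
      rw [Finset.prod_eq_zero (Finset.mem_erase.mpr ⟨hβα.symm, hα⟩) (by simp)]
      ring
  · have hDr : algebraMap K[X] (RatFunc K) (∏ α ∈ S, (X - C α)) ≠ 0 := by
      rw [Ne, FaithfulSMul.algebraMap_eq_zero_iff]
      exact Finset.prod_ne_zero_iff.mpr fun α (_ : α ∈ S) => X_sub_C_ne_zero α
    rw [eq_div_iff hDr, add_mul, map_sub, map_mul, RatFunc.algebraMap_X, sub_eq_add_neg,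
      map_sum, ← Finset.sum_neg_distrib, Finset.sum_mul]
    congr 1
    refine Finset.sum_congr rfl fun α hα => ?_
    rw [← Finset.mul_prod_erase _ _ hα]
    simp only [hg, map_mul, map_add, map_sub, map_one, RatFunc.algebraMap_C, map_inv₀,
      RatFunc.algebraMap_X]
    have := ratFunc_X_sub_C_ne_zero_s13 α
    field_simp

end Mobius

theorem Fin.last_eq_prod_of_succ_eq_mul {r : ℕ} {p : Fin r → ℕ} {N : Fin (r + 1) → ℕ}
    (h0 : N 0 = 1) (hN : ∀ i : Fin r, N i.succ = p i * N i.castSucc) :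
    N (Fin.last r) = ∏ i, p i := by
  induction r with
  | zero => simpa using h0
  | succ r ih =>
    rw [Fin.prod_univ_castSucc, ← ih (N := fun i => N i.castSucc) (by simpa using h0)
      fun i => hN i.castSucc, ← Fin.succ_last, hN, mul_comm]

/-- **A basis of the Riemann–Roch space `L(nQ)` from a chain of subgroups of `⟨σ⟩`.**
Let `n = p_1 ⋯ p_r` divide `q+1` and let `⊥ = G_0 < G_1 < ⋯ < G_r` be a chain of
subgroups of `⟨σ⟩` with `|G_i| = p_1⋯p_i`.  With `x_i = Σ_{τ∈G_i} τ(x)`,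
`y_r = ∏_{τ∈G_r} τ(1/Q(x))`, the recursions
`x_i = u_i(x_{i-1})/∏_k (x_{i-1} - λ_{i,k})`, and
`z_i^{(e)} = 1/∏_{k≤e}(x_i - λ_{i+1,k})`, `z_r^{(0)} = 1`, `z_r^{(1)} = x_r`, the family
`{z_0^{(e_0)} ⋯ z_{r-1}^{(e_{r-1})} z_r^{(e_r)}·y_r}` together with the constant `1`
is an `𝔽_q`-basis of `L(nQ) = {g(x)/Q(x)^n : deg g ≤ 2n}`. -/
theorem basis_of_riemann_roch_space_nQ
    (Fq : Type*) [Field Fq] [Fintype Fq] (a b : Fq)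
    (m : Polynomial Fq) (hm : m = X ^ 2 + C a * X + C b)
    (hirr : Irreducible m)
    (hprim : orderOf (AdjoinRoot.root m) = Fintype.card Fq ^ 2 - 1)
    (σ : RatFunc Fq ≃ₐ[Fq] RatFunc Fq)
    (hσ : σ RatFunc.X = 1 / (-(RatFunc.C b) * RatFunc.X - RatFunc.C a))
    (horder : orderOf σ = Fintype.card Fq + 1)
    (Qp : Polynomial Fq) (hQ : Qp = X ^ 2 + C (a / b) * X + C (1 / b))
    (r n : ℕ) (p : Fin r → ℕ)
    (hn : n = ∏ i, p i) (hdvd : n ∣ Fintype.card Fq + 1)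
    (G : Fin (r + 1) → Subgroup (RatFunc Fq ≃ₐ[Fq] RatFunc Fq))
    [∀ i, Fintype (G i)]
    (hG0 : G 0 = ⊥)
    (hGle : ∀ i, G i ≤ Subgroup.zpowers σ)
    (hchain : ∀ i : Fin r, G i.castSucc < G i.succ)
    (hcard : ∀ i : Fin r,
      Fintype.card (G i.succ) = p i * Fintype.card (G i.castSucc))
    (xi : Fin (r + 1) → RatFunc Fq)
    (hxi : ∀ i, xi i = ∑ τ : G i, (τ : RatFunc Fq ≃ₐ[Fq] RatFunc Fq) RatFunc.X)
    (yr : RatFunc Fq)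
    (hyr : yr = ∏ τ : G (Fin.last r), (τ : RatFunc Fq ≃ₐ[Fq] RatFunc Fq)
      (1 / algebraMap (Polynomial Fq) (RatFunc Fq) Qp))
    (lam : Fin r → ℕ → Fq) (u : Fin r → Polynomial Fq)
    (hlam : ∀ i : Fin r, ∀ k l : ℕ, k < p i - 1 → l < p i - 1 →
      lam i k = lam i l → k = l)
    (hu : ∀ i : Fin r, (u i).natDegree = p i)
    (hrec : ∀ i : Fin r, xi i.succ =
      Polynomial.aeval (xi i.castSucc) (u i) /
        ∏ k ∈ Finset.range (p i - 1), (xi i.castSucc - RatFunc.C (lam i k))) :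
    LinearIndependent Fq
      (fun o : Option ((∀ i : Fin r, Fin (p i)) × Fin 2) =>
        o.elim (1 : RatFunc Fq) (fun e =>
          (∏ i : Fin r,
            (∏ k ∈ Finset.range (e.1 i : ℕ),
              (xi i.castSucc - RatFunc.C (lam i k)))⁻¹) *
          xi (Fin.last r) ^ (e.2 : ℕ) * yr)) ∧
    (Submodule.span Fq (Set.range
      (fun o : Option ((∀ i : Fin r, Fin (p i)) × Fin 2) =>
        o.elim (1 : RatFunc Fq) (fun e =>
          (∏ i : Fin r,
            (∏ k ∈ Finset.range (e.1 i : ℕ),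
              (xi i.castSucc - RatFunc.C (lam i k)))⁻¹) *
          xi (Fin.last r) ^ (e.2 : ℕ) * yr))) : Set (RatFunc Fq)) =
      {w : RatFunc Fq | ∃ g : Polynomial Fq, g.natDegree ≤ 2 * n ∧
        w = algebraMap (Polynomial Fq) (RatFunc Fq) g /
          algebraMap (Polynomial Fq) (RatFunc Fq) (Qp ^ n)} := by
  have hroot_m : ∀ t : Fq, t ^ 2 + a * t + b ≠ 0 := by
    intro t ht
    have hdeg := degree_eq_one_of_irreducible_of_root hirr (x := t) (by simpa [hm] using ht)
    have hdeg2 : m.degree = 2 := by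
      rw [hm]
      compute_degree!
    rw [hdeg2] at hdeg
    exact absurd hdeg (by decide)
  have hb : b ≠ 0 := by simpa using hroot_m 0
  have hroot : ∀ α : Fq, b * α ^ 2 + a * α + 1 ≠ 0 := by
    intro α h
    apply hroot_m (b * α)
    linear_combination b * h
  have hfin : IsOfFinOrder σ := by
    rw [← orderOf_pos_iff, horder]
    omega
  choose S hScard hSsum hSprod using fun i =>
    exists_finset_sum_eq_and_prod_eq hb hσ hfin (G i) (hGle i)
  choose f hfdeg hfcop hf using exists_reduced_fraction (a := a) hb hroot
  set D : Fin (r + 1) → Fq[X] := fun i => ∏ α ∈ S i, (X - C α) with hDdef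
  have hD0 : ∀ i, D i ≠ 0 := fun i =>
    Finset.prod_ne_zero_iff.mpr fun α _ => X_sub_C_ne_zero α
  have hDdeg : ∀ i, (D i).natDegree = (S i).card := fun i => by simp [hDdef]
  have hDcard : ∀ i, (D i).natDegree + 1 = Fintype.card (G i) := fun i => by
    rw [hDdeg, hScard]
  have hxf : ∀ i, xi i = algebraMap Fq[X] (RatFunc Fq) (f (S i)) /
      algebraMap Fq[X] (RatFunc Fq) (D i) := fun i => by
    rw [hxi, hSsum, hf]
  have hp : ∀ i, 0 < p i := fun i => by
    have h1 : 0 < Fintype.card (G i.succ) := Fintype.card_pos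
    rw [hcard] at h1
    exact Nat.pos_of_mul_pos_right h1
  have hcn : Fintype.card (G (Fin.last r)) = n := by
    rw [hn]
    refine Fin.last_eq_prod_of_succ_eq_mul (N := fun i => Fintype.card (G i)) ?_ hcard
    rw [Fintype.card_eq_one_iff]
    exact ⟨1, fun τ => Subtype.ext (by simpa [hG0] using τ.2)⟩
  have hn0 : 0 < n := hcn ▸ Fintype.card_pos
  have hrel : ∀ i : Fin r, ∃ c : Fq, c ≠ 0 ∧
      D i.castSucc * ∏ k ∈ Finset.range (p i - 1), (f (S i.castSucc) - C (lam i k) * D i.castSucc) =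
        C c * D i.succ := fun i => by
    refine exists_denominator_eq_C_mul (hp i) (lam i) (hu i) (hD0 _) (hD0 _)
      (by rw [hfdeg, hDdeg]) (by rw [hDcard, hDcard, hcard]) (hfcop _) ?_
    rw [← hxf, ← hxf]
    exact hrec i
  choose c hc hrelc using hrel
  obtain ⟨P, hPli, hPdeg, hP⟩ := exists_linearIndependent_numerators r p hp (fun i => f (S i)) D
    lam c hc hD0 (fun i => by rw [hfdeg, hDdeg]) (fun i => hfcop _) hrelc
  have hQmonic : Qp.Monic := by
    rw [hQ]
    monicity!
  have hQdeg : Qp.natDegree = 2 := by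
    rw [hQ]
    compute_degree!
  have hQr : algebraMap Fq[X] (RatFunc Fq) Qp ≠ 0 := by simpa using hQmonic.ne_zero
  have hDr : algebraMap Fq[X] (RatFunc Fq) (D (Fin.last r)) ≠ 0 := by simpa using hD0 (Fin.last r)
  set d : Fq := ∏ α ∈ S (Fin.last r), (α ^ 2 + a / b * α + 1 / b)⁻¹ with hd
  have hd0 : d ≠ 0 := Finset.prod_ne_zero_iff.mpr fun α _ => by
    refine inv_ne_zero fun h => hroot α ?_
    field_simp at h
    linear_combination h
  have hy : yr = algebraMap Fq[X] (RatFunc Fq) (C d * D (Fin.last r) ^ 2) /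
      algebraMap Fq[X] (RatFunc Fq) (Qp ^ n) := by
    rw [hyr, hQ, hSprod, ← hQ, Finset.prod_div_distrib, Finset.prod_mul_distrib,
      Finset.prod_const, ← hcn, ← hScard, Finset.prod_pow, one_div_mul_eq_div, div_div, hd]
    simp only [hDdef, map_mul, map_pow, map_prod, map_sub, RatFunc.algebraMap_C,
      RatFunc.algebraMap_X, pow_succ]
  obtain ⟨hli, hspan⟩ := linearIndependent_and_span_eq_degreeLT hPli hn0 hd0
    (hfcop (S (Fin.last r))) (by rw [hfdeg, hScard, hcn]) (by rw [← hcn]; exact hDcard _)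
    hPdeg (by simp [hn]) (R := Qp ^ n) (by rw [hQmonic.natDegree_pow, hQdeg, mul_comm])
  set φ : Fq[X] →ₗ[Fq] RatFunc Fq :=
    (LinearMap.mulRight Fq (algebraMap Fq[X] (RatFunc Fq) (Qp ^ n))⁻¹).comp
      (IsScalarTower.toAlgHom Fq Fq[X] (RatFunc Fq)).toLinearMap
  have hφ : ∀ g, φ g = algebraMap Fq[X] (RatFunc Fq) g /
      algebraMap Fq[X] (RatFunc Fq) (Qp ^ n) := fun g => (div_eq_mul_inv _ _).symm
  have hQnr : algebraMap Fq[X] (RatFunc Fq) (Qp ^ n) ≠ 0 := by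
    rw [map_pow]
    exact pow_ne_zero _ hQr
  have hφker : LinearMap.ker φ = ⊥ := by
    rw [LinearMap.ker_eq_bot]
    intro g g' h
    rw [hφ, hφ, div_left_inj' hQnr] at h
    exact RatFunc.algebraMap_injective Fq h
  have hfam : (fun o : Option ((∀ i : Fin r, Fin (p i)) × Fin 2) =>
      o.elim (1 : RatFunc Fq) (fun e =>
        (∏ i : Fin r, (∏ k ∈ Finset.range (e.1 i : ℕ),
          (xi i.castSucc - RatFunc.C (lam i k)))⁻¹) * xi (Fin.last r) ^ (e.2 : ℕ) * yr)) =
      φ ∘ fun o : Option ((∀ i : Fin r, Fin (p i)) × Fin 2) => o.elim (Qp ^ n) fun e =>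
        C d * (P e.1 * (f (S (Fin.last r)) ^ (e.2 : ℕ) * D (Fin.last r) ^ (1 - (e.2 : ℕ)))) := by
    funext o
    cases o with
    | none => simp only [Option.elim_none, Function.comp_apply, hφ, div_self hQnr]
    | some e =>
      obtain ⟨e, ε⟩ := e
      simp only [Option.elim_some, Function.comp_apply, hφ, hy, hxf, map_mul, hP]
      generalize ∏ i : Fin r, (∏ k ∈ Finset.range (e i : ℕ),
        (algebraMap Fq[X] (RatFunc Fq) (f (S i.castSucc)) /
          algebraMap Fq[X] (RatFunc Fq) (D i.castSucc) - RatFunc.C (lam i k)))⁻¹ = Z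
      fin_cases ε
      · simp
        field_simp
      · simp
        field_simp
  rw [hfam]
  refine ⟨hli.map' φ hφker, ?_⟩
  rw [Set.range_comp, ← Submodule.map_span, hspan]
  ext w
  simp only [Submodule.map_coe, Set.mem_image, SetLike.mem_coe, Set.mem_ofPred_eq, hφ]
  refine exists_congr fun g => and_congr ?_ eq_comm
  rw [mem_degreeLT]
  rcases eq_or_ne g 0 with rfl | hg
  · exact iff_of_true (by rw [degree_zero]; exact WithBot.bot_lt_coe _) (by simp)
  · rw [← natDegree_lt_iff_degree_lt hg, Nat.lt_succ_iff]
end
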